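/- Let f : ℝⁿ → ℝⁿ be Lipschitz continuous with constant L_f, and let U : ℕ × ℤ → ℝⁿ satisfy the conservative update rule of the Godunov scheme: U_{m+1, j} = U_{m, j} + f(U_{m, j−1}) − f(U_{m, j}) for all m, j. For each m, let T_m = Σ_{j ∈ ℤ} |U_{m, j+1} − U_{m, j}| (assumed finite). Then for all integers 0 ≤ m < m', Σ_{j ∈ ℤ} | U_{m', j} − U_{m, j} | ≤ (m' − m) · L_f · sup_{m ≤ k < m'} T_k. In particular, interpreting U_{m, j} as the value of a piecewise constant function on the cell [jε, (j+1)ε) at time mε, the corresponding L¹ distance is at most L_f (τ' − τ) sup_t Tot.Var.{u(t,·)} for τ = mε, τ' = m'ε. -/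

import Mathlib

open scoped NNReal

/-- One step of a conservative scheme with Lipschitz flux moves the profile by at most
`Lf` times its total variation in `ℓ¹`. -/
theorem summable_and_tsum_norm_flux_sub_le {E F : Type*} [SeminormedAddCommGroup E]
    [SeminormedAddCommGroup F] {f : E → F} {Lf : ℝ≥0} (hf : LipschitzWith Lf f) {u : ℤ → E}
    (hu : Summable fun j : ℤ => ‖u (j + 1) - u j‖) :
    (Summable fun j : ℤ => ‖f (u (j - 1)) - f (u j)‖) ∧
      ∑' j : ℤ, ‖f (u (j - 1)) - f (u j)‖ ≤ Lf * ∑' j : ℤ, ‖u (j + 1) - u j‖ := by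
  have hshift : HasSum (fun j : ℤ => ‖u (j - 1) - u j‖) (∑' j : ℤ, ‖u (j + 1) - u j‖) := by
    rw [← (Equiv.addRight (1 : ℤ)).hasSum_iff]
    simpa [Function.comp_def, norm_sub_rev] using hu.hasSum
  have hle (j : ℤ) : ‖f (u (j - 1)) - f (u j)‖ ≤ Lf * ‖u (j - 1) - u j‖ := hf.norm_sub_le _ _
  have hmul := hshift.mul_left (Lf : ℝ)
  have hsum := Summable.of_nonneg_of_le (fun _ => norm_nonneg _) hle hmul.summable
  exact ⟨hsum, hasSum_le hle hsum.hasSum hmul⟩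

/-- The `ℓ¹` distance between two times of a conservative scheme with Lipschitz flux is finite and
bounded by `Lf` times the sum of the total variations at the intermediate times. -/
theorem summable_and_tsum_norm_sub_le_sum {E : Type*} [SeminormedAddCommGroup E] {f : E → E}
    {Lf : ℝ≥0} (hf : LipschitzWith Lf f) {U : ℕ → ℤ → E}
    (hscheme : ∀ m j, U (m + 1) j = U m j + (f (U m (j - 1)) - f (U m j)))
    (hTV : ∀ m, Summable fun j : ℤ => ‖U m (j + 1) - U m j‖) {m m' : ℕ} (hmm : m ≤ m') :
    (Summable fun j : ℤ => ‖U m' j - U m j‖) ∧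
      ∑' j : ℤ, ‖U m' j - U m j‖ ≤
        ∑ k ∈ Finset.Ico m m', Lf * ∑' j : ℤ, ‖U k (j + 1) - U k j‖ := by
  induction m', hmm using Nat.le_induction with
  | base => simp [summable_zero]
  | succ k hk ih =>
    obtain ⟨hs, hb⟩ := ih
    obtain ⟨hs', hb'⟩ := summable_and_tsum_norm_flux_sub_le hf (hTV k)
    have hle (j : ℤ) :
        ‖U (k + 1) j - U m j‖ ≤ ‖U k j - U m j‖ + ‖f (U k (j - 1)) - f (U k j)‖ := by
      rw [hscheme, add_sub_right_comm]
      exact norm_add_le _ _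
    have hsum := Summable.of_nonneg_of_le (fun _ => norm_nonneg _) hle (hs.add hs')
    refine ⟨hsum, (hasSum_le hle hsum.hasSum (hs.hasSum.add hs'.hasSum)).trans ?_⟩
    rw [Finset.sum_Ico_succ_top hk]
    exact add_le_add hb hb'

/-- discrete `L¹` Lipschitz continuity in time of the Godunov scheme:
if `U_{m+1,j} = U_{m,j} + f(U_{m,j−1}) − f(U_{m,j})` and the total variation
`T_m = Σ_j |U_{m,j+1} − U_{m,j}|` is finite at each step, then for `m < m'`,
`Σ_j |U_{m',j} − U_{m,j}| ≤ (m'−m) · L_f · sup_{m ≤ k < m'} T_k`. -/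
theorem stmt9 {n : ℕ}
    (f : EuclideanSpace ℝ (Fin n) → EuclideanSpace ℝ (Fin n))
    (Lf : ℝ≥0) (hf : LipschitzWith Lf f)
    (U : ℕ → ℤ → EuclideanSpace ℝ (Fin n))
    (hscheme : ∀ m j, U (m + 1) j = U m j + (f (U m (j - 1)) - f (U m j)))
    (hTV : ∀ m, Summable fun j : ℤ => ‖U m (j + 1) - U m j‖)
    (m m' : ℕ) (hmm : m < m') :
    ∑' j : ℤ, ‖U m' j - U m j‖ ≤
      ((m' - m : ℕ) : ℝ) * (Lf : ℝ) *
        (Finset.Ico m m').sup' (Finset.nonempty_Ico.mpr hmm)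
          (fun k => ∑' j : ℤ, ‖U k (j + 1) - U k j‖) := by
  refine (summable_and_tsum_norm_sub_le_sum hf hscheme hTV hmm.le).2.trans ?_
  rw [← Finset.mul_sum, mul_right_comm, mul_comm _ (Lf : ℝ)]
  refine mul_le_mul_of_nonneg_left ?_ Lf.coe_nonneg
  rw [← nsmul_eq_mul, ← Nat.card_Ico]
  exact Finset.sum_le_card_nsmul _ _ _ fun k hk =>
    Finset.le_sup' (fun k => ∑' j : ℤ, ‖U k (j + 1) - U k j‖) hk
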